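/- Let A ∈ ℂ^{n×n} have spectral radius < 1, let W(z) = C(zI−A)^{-1}B + D with C ∈ ℂ^{m×n}, B ∈ ℂ^{n×m}, D ∈ ℂ^{m×m}, let Π solve Π = AΠA* + BB*, and set Z(z) = C(zI−A)^{-1}(AΠC* + BD*) + ½(CΠC* + DD*). Then for every z on the unit circle, W(z)W(z)* = Z(z) + Z(z)*. -/

import Mathlib

open Matrix

open scoped Matrix.Norms.L2Operator in
/-- The powers of a complex matrix with spectral radius less than one tend to zero. -/
theorem Matrix.tendsto_pow_atTop_nhds_zero_of_spectrum {n : ℕ} (A : Matrix (Fin n) (Fin n) ℂ)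
    (hA : ∀ z ∈ spectrum ℂ A, ‖z‖ < 1) :
    Filter.Tendsto (fun k : ℕ => A ^ k) Filter.atTop (nhds 0) := by
  have hr : spectralRadius ℂ A < 1 := by
    cases isEmpty_or_nonempty (Fin n) with
    | inl h =>
      have : Subsingleton (Matrix (Fin n) (Fin n) ℂ) := inferInstance
      rw [Subsingleton.elim A 0]
      simp
    | inr h =>
      have : Nontrivial (Matrix (Fin n) (Fin n) ℂ) := inferInstance
      exact_mod_cast spectrum.spectralRadius_lt_of_forall_lt A (r := 1)
        fun z hz => by exact_mod_cast hA z hz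
  obtain ⟨r, hr₁, hr₂⟩ := exists_between hr
  have hev := (spectrum.pow_nnnorm_pow_one_div_tendsto_nhds_spectralRadius A).eventually_lt_const
    hr₁
  rw [tendsto_zero_iff_norm_tendsto_zero]
  have hrt : r ≠ ⊤ := (hr₂.trans ENNReal.one_lt_top).ne
  lift r to NNReal using hrt
  have hr₃ : (r : ℝ) < 1 := by exact_mod_cast hr₂
  refine squeeze_zero' (Filter.Eventually.of_forall fun _ => norm_nonneg _) ?_
    (tendsto_pow_atTop_nhds_zero_of_lt_one r.2 hr₃)
  filter_upwards [hev, Filter.eventually_gt_atTop 0] with k hk hk0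
  have h := ENNReal.rpow_le_rpow hk.le (Nat.cast_nonneg (α := ℝ) k)
  rw [← ENNReal.rpow_mul, one_div, inv_mul_cancel₀ (by positivity), ENNReal.rpow_one,
    ENNReal.rpow_natCast] at h
  exact_mod_cast h

/-- The homogeneous discrete Lyapunov equation of a stability matrix has only the zero solution. -/
theorem Matrix.eq_zero_of_eq_mul_mul_conjTranspose {n : ℕ} (A X : Matrix (Fin n) (Fin n) ℂ)
    (hA : ∀ z ∈ spectrum ℂ A, ‖z‖ < 1) (hX : X = A * X * Aᴴ) : X = 0 := by
  have hiter : ∀ k : ℕ, A ^ k * X * (A ^ k)ᴴ = X := by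
    intro k
    induction k with
    | zero => simp
    | succ k ih =>
      rw [pow_succ, conjTranspose_mul]
      calc A ^ k * A * X * (Aᴴ * (A ^ k)ᴴ) = A ^ k * (A * X * Aᴴ) * (A ^ k)ᴴ := by
            simp only [Matrix.mul_assoc]
        _ = X := by rw [← hX, ih]
  have hpow := tendsto_pow_atTop_nhds_zero_of_spectrum A hA
  have hcont : Continuous fun Y : Matrix (Fin n) (Fin n) ℂ => Y * X * Yᴴ := by fun_prop
  have hlim := (hcont.tendsto 0).comp hpow
  simp only [Function.comp_def, hiter, Matrix.zero_mul] at hlim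
  exact tendsto_nhds_unique tendsto_const_nhds hlim

/-- Resolvent form of the discrete Lyapunov equation on the unit circle. -/
theorem Matrix.resolvent_mul_mul_conjTranspose {n : ℕ} (A P Q : Matrix (Fin n) (Fin n) ℂ) (z : ℂ)
    (hz : ‖z‖ = 1) (hdet : IsUnit (z • (1 : Matrix (Fin n) (Fin n) ℂ) - A))
    (hP : P = A * P * Aᴴ + Q) :
    (z • 1 - A)⁻¹ * Q * ((z • 1 - A)⁻¹)ᴴ =
      P + P * Aᴴ * ((z • 1 - A)⁻¹)ᴴ + (z • 1 - A)⁻¹ * A * P := by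
  have hzz : (starRingEnd ℂ) z * z = 1 := by simp [Complex.conj_mul', hz]
  obtain ⟨M, hM⟩ : ∃ M, M = z • (1 : Matrix (Fin n) (Fin n) ℂ) - A := ⟨_, rfl⟩
  rw [← hM] at hdet ⊢
  have hQ : Q = M * P * Mᴴ + M * P * Aᴴ + A * P * Mᴴ := by
    have h₁ : (M + A) * P * (M + A)ᴴ = P := by
      simp [hM, smul_smul, hzz]
    have h₂ : Q = P - A * P * Aᴴ := eq_sub_of_add_eq' hP.symm
    rw [h₂]
    nth_rewrite 1 [← h₁]
    rw [conjTranspose_add]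
    noncomm_ring
  have hR : M⁻¹ * M = 1 := nonsing_inv_mul M ((isUnit_iff_isUnit_det M).1 hdet)
  have hR' : Mᴴ * (M⁻¹)ᴴ = 1 := by rw [← conjTranspose_mul, hR, conjTranspose_one]
  calc M⁻¹ * Q * (M⁻¹)ᴴ = (M⁻¹ * M) * P * (Mᴴ * (M⁻¹)ᴴ) + (M⁻¹ * M) * P * Aᴴ * (M⁻¹)ᴴ
        + M⁻¹ * A * P * (Mᴴ * (M⁻¹)ᴴ) := by rw [hQ]; noncomm_ring
    _ = _ := by rw [hR, hR']; simp

theorem stmt13 {n m : ℕ} (A : Matrix (Fin n) (Fin n) ℂ)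
    (hA : ∀ z ∈ spectrum ℂ A, ‖z‖ < 1)
    (C : Matrix (Fin m) (Fin n) ℂ) (B : Matrix (Fin n) (Fin m) ℂ)
    (D : Matrix (Fin m) (Fin m) ℂ) (Pi' : Matrix (Fin n) (Fin n) ℂ)
    (hPi : Pi' = A * Pi' * Aᴴ + B * Bᴴ)
    (W Z : ℝ → Matrix (Fin m) (Fin m) ℂ)
    (hW : ∀ θ : ℝ, W θ =
      C * (Complex.exp (θ * Complex.I) • (1 : Matrix (Fin n) (Fin n) ℂ) - A)⁻¹ * B + D)
    (hZ : ∀ θ : ℝ, Z θ =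
      C * (Complex.exp (θ * Complex.I) • (1 : Matrix (Fin n) (Fin n) ℂ) - A)⁻¹ *
          (A * Pi' * Cᴴ + B * Dᴴ) +
        ((2 : ℂ)⁻¹ • (C * Pi' * Cᴴ + D * Dᴴ))) :
    ∀ θ : ℝ, W θ * (W θ)ᴴ = Z θ + (Z θ)ᴴ := by
  intro θ
  have hH : Pi'ᴴ = Pi' := by
    refine (sub_eq_zero.1 (eq_zero_of_eq_mul_mul_conjTranspose A (Pi' - Pi'ᴴ) hA ?_)).symm
    have h := congrArg conjTranspose hPi
    simp only [conjTranspose_add, conjTranspose_mul, conjTranspose_conjTranspose] at h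
    nth_rewrite 1 [h, hPi]
    noncomm_ring
  have hz : ‖Complex.exp (θ * Complex.I)‖ = 1 := Complex.norm_exp_ofReal_mul_I θ
  have hunit : IsUnit (Complex.exp (θ * Complex.I) • (1 : Matrix (Fin n) (Fin n) ℂ) - A) := by
    by_contra h
    refine (hA (Complex.exp (θ * Complex.I)) ?_).ne hz
    rwa [spectrum.mem_iff, Algebra.algebraMap_eq_smul_one]
  have key := resolvent_mul_mul_conjTranspose A Pi' (B * Bᴴ) _ hz hunit hPi
  rw [hW, hZ]
  generalize (Complex.exp (θ * Complex.I) • (1 : Matrix (Fin n) (Fin n) ℂ) - A)⁻¹ = R at key ⊢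
  have hhalf (Y : Matrix (Fin m) (Fin m) ℂ) : (2 : ℂ)⁻¹ • Y + (2 : ℂ)⁻¹ • Y = Y := by
    rw [← add_smul]; norm_num
  calc (C * R * B + D) * (C * R * B + D)ᴴ
      = C * (R * (B * Bᴴ) * Rᴴ) * Cᴴ + C * R * B * Dᴴ + D * Bᴴ * Rᴴ * Cᴴ + D * Dᴴ := by
        simp only [conjTranspose_add, conjTranspose_mul, Matrix.mul_add, Matrix.add_mul,
          Matrix.mul_assoc]
        abel
    _ = C * R * (A * Pi' * Cᴴ + B * Dᴴ) + (C * R * (A * Pi' * Cᴴ + B * Dᴴ))ᴴ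
        + (C * Pi' * Cᴴ + D * Dᴴ) := by
        rw [key]
        simp only [conjTranspose_add, conjTranspose_mul, conjTranspose_conjTranspose, hH,
          Matrix.mul_add, Matrix.add_mul, Matrix.mul_assoc]
        abel
    _ = _ := by
        have hS : (C * Pi' * Cᴴ + D * Dᴴ)ᴴ = C * Pi' * Cᴴ + D * Dᴴ := by
          simp [hH, Matrix.mul_assoc]
        rw [conjTranspose_add, conjTranspose_smul, hS]
        nth_rewrite 1 [← hhalf (C * Pi' * Cᴴ + D * Dᴴ)]
        simp only [star_inv₀, star_ofNat]
        abel
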